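/- Suppose the linear program (P) has a finite optimal value and let x̄ be an optimal solution of (P). Then for every penalty vector v ∈ ℝⁿ with v ≥ x̄ componentwise, the optimal value of the penalized dual problem (D_v) equals the optimal value of (P) (and hence equals the optimal value of the dual (D)). -/

import Mathlib

open Matrix

theorem farkas_aux {ι V : Type*} [DecidableEq ι] [AddCommGroup V] [Module ℝ V] (s : Finset ι) :
    ∀ (a : ι → (V →ₗ[ℝ] ℝ)) (b : V →ₗ[ℝ] ℝ),
      (∀ y, (∀ i ∈ s, a i y ≤ 0) → b y ≤ 0) →
      ∃ x : ι → ℝ, (∀ i, 0 ≤ x i) ∧ ∀ y, b y = ∑ i ∈ s, x i * a i y := by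
  induction s using Finset.induction_on with
  | empty =>
    intro a b h
    refine ⟨fun _ => 0, fun _ => le_rfl, fun y => ?_⟩
    have h1 := h y (by simp)
    have h2 := h (-y) (by simp)
    rw [map_neg] at h2
    simp only [Finset.sum_empty]
    linarith
  | insert k s hk ih =>
    intro a b h
    by_cases hc : ∀ y, (∀ i ∈ s, a i y ≤ 0) → b y ≤ 0
    · obtain ⟨x, hx, hb⟩ := ih a b hc
      refine ⟨fun i => if i = k then 0 else x i, fun i => ?_, fun y => ?_⟩
      · dsimp only
        split_ifs
        · exact le_rfl
        · exact hx i
      · rw [Finset.sum_insert hk, hb y]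
        simp only [if_true, zero_mul, zero_add]
        refine Finset.sum_congr rfl fun i hi => ?_
        rw [if_neg (ne_of_mem_of_not_mem hi hk)]
    · push Not at hc
      obtain ⟨y1, hy1, hby1⟩ := hc
      have hk1 : 0 < a k y1 := by
        by_contra hcon
        refine absurd (h y1 fun i hi => ?_) (not_le.mpr hby1)
        rcases Finset.mem_insert.mp hi with rfl | hi
        · exact not_lt.mp hcon
        · exact hy1 i hi
      obtain ⟨y0, hy0, hby0, hk0⟩ :
          ∃ y0, (∀ i ∈ s, a i y0 ≤ 0) ∧ 0 < b y0 ∧ a k y0 = 1 := by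
        refine ⟨(a k y1)⁻¹ • y1, fun i hi => ?_, ?_, ?_⟩
        · rw [map_smul, smul_eq_mul]
          exact mul_nonpos_of_nonneg_of_nonpos (inv_nonneg.mpr hk1.le) (hy1 i hi)
        · rw [map_smul, smul_eq_mul]
          exact mul_pos (inv_pos.mpr hk1) hby1
        · rw [map_smul, smul_eq_mul]
          exact inv_mul_cancel₀ hk1.ne'
      obtain ⟨x, hx, hb⟩ := ih (fun i => a i - (a i y0) • a k) (b - (b y0) • a k) (by
        intro y hy
        have := h (y - a k y • y0) (by
          intro i hi
          rcases Finset.mem_insert.mp hi with rfl | hi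
          · simp [hk0]
          · have := hy i hi
            simp at this ⊢
            linarith)
        simp at this ⊢
        linarith)
      have hnp : ∑ i ∈ s, x i * a i y0 ≤ 0 :=
        Finset.sum_nonpos fun i hi => mul_nonpos_of_nonneg_of_nonpos (hx i) (hy0 i hi)
      refine ⟨fun i => if i = k then b y0 - ∑ i ∈ s, x i * a i y0 else x i,
        fun i => ?_, fun y => ?_⟩
      · dsimp only
        split_ifs
        · linarith
        · exact hx i
      · rw [Finset.sum_insert hk]
        have e : ∑ i ∈ s, (if i = k then b y0 - ∑ i ∈ s, x i * a i y0 else x i) * a i y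
            = ∑ i ∈ s, x i * a i y := by
          refine Finset.sum_congr rfl fun i hi => ?_
          rw [if_neg (ne_of_mem_of_not_mem hi hk)]
        rw [e]
        have hy := hb y
        simp only [LinearMap.sub_apply, LinearMap.smul_apply, smul_eq_mul, mul_sub,
          Finset.sum_sub_distrib, ← mul_assoc, ← Finset.sum_mul] at hy
        simp only [if_true]
        linarith

theorem dual_attained {m n : ℕ}
    (A : Matrix (Fin m) (Fin n) ℝ) (b : Fin m → ℝ) (c : Fin n → ℝ)
    (xbar : Fin n → ℝ)
    (hxbar_feas : A.mulVec xbar = b ∧ 0 ≤ xbar)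
    (hxbar_opt : ∀ x : Fin n → ℝ, A.mulVec x = b → 0 ≤ x → c ⬝ᵥ xbar ≤ c ⬝ᵥ x) :
    ∃ π : Fin m → ℝ, Aᵀ.mulVec π ≤ c ∧ b ⬝ᵥ π = c ⬝ᵥ xbar := by
  classical
  let row : Fin m → ((Fin n → ℝ) →ₗ[ℝ] ℝ) := fun j => (LinearMap.proj j).comp A.mulVecLin
  let f : (Fin m ⊕ Fin m) ⊕ Fin n → ((Fin n → ℝ) →ₗ[ℝ] ℝ) :=
    Sum.elim (Sum.elim row (fun j => - row j))
      (fun i => if xbar i = 0 then - LinearMap.proj i else 0)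
  obtain ⟨x, hx, h⟩ := farkas_aux (Finset.univ) f (-(dotProductBilin ℝ ℝ c)) (by
    intro d hd
    have hA : A.mulVec d = 0 := by
      funext j
      have h1 := hd (Sum.inl (Sum.inl j)) (Finset.mem_univ _)
      have h2 := hd (Sum.inl (Sum.inr j)) (Finset.mem_univ _)
      simp [f, row] at h1 h2
      exact le_antisymm h1 h2
    have hev : ∀ᶠ t : ℝ in nhdsWithin 0 (Set.Ioi 0), ∀ i, 0 ≤ xbar i + t * d i := by
      rw [Filter.eventually_all]
      intro i
      by_cases hi : xbar i = 0
      · have h1 := hd (Sum.inr i) (Finset.mem_univ _)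
        simp [f, hi] at h1
        filter_upwards [self_mem_nhdsWithin] with t ht
        rw [hi, zero_add]
        exact mul_nonneg (le_of_lt ht) h1
      · have hpos : 0 < xbar i := lt_of_le_of_ne (hxbar_feas.2 i) (Ne.symm hi)
        have hcont : ContinuousAt (fun t : ℝ => xbar i + t * d i) 0 := by fun_prop
        have := hcont.eventually (lt_mem_nhds (show (0:ℝ) < xbar i + 0 * d i by simpa using hpos))
        exact (this.filter_mono nhdsWithin_le_nhds).mono fun t ht => ht.le
    obtain ⟨t, ht, ht0⟩ := (hev.and self_mem_nhdsWithin).exists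
    have ht0 : 0 < t := ht0
    have := hxbar_opt (xbar + t • d) (by
      rw [Matrix.mulVec_add, Matrix.mulVec_smul, hA, hxbar_feas.1]; simp) (fun i => by
        simpa using ht i)
    rw [dotProduct_add, dotProduct_smul, smul_eq_mul] at this
    have : 0 ≤ c ⬝ᵥ d := by
      by_contra hcon
      nlinarith [mul_pos ht0 (neg_pos.mpr (not_le.mp hcon))]
    simpa using this)
  have key : ∀ y : Fin n → ℝ, c ⬝ᵥ y =
      (fun j => x (Sum.inl (Sum.inr j)) - x (Sum.inl (Sum.inl j))) ⬝ᵥ A.mulVec y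
       + ∑ i, x (Sum.inr i) * (if xbar i = 0 then y i else 0) := by
    intro y
    have := h y
    simp only [Fintype.sum_sum_type, f, row, Sum.elim_inl, Sum.elim_inr] at this
    have e : ∀ i, (if xbar i = 0 then - (LinearMap.proj i : (Fin n → ℝ) →ₗ[ℝ] ℝ) else 0) y
        = - (if xbar i = 0 then y i else 0) := by
      intro i; split_ifs <;> simp
    simp only [e] at this
    simp at this
    simp only [dotProduct, sub_mul, Finset.sum_sub_distrib, mul_ite, mul_zero] at this ⊢
    linarith
  refine ⟨fun j => x (Sum.inl (Sum.inr j)) - x (Sum.inl (Sum.inl j)), fun i => ?_, ?_⟩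
  · have := key (Pi.single i 1)
    rw [dotProduct_mulVec, ← Matrix.mulVec_transpose] at this
    simp only [dotProduct_single_one] at this
    rw [this]
    refine le_add_of_nonneg_right (Finset.sum_nonneg fun j _ => mul_nonneg (hx _) ?_)
    split_ifs
    · by_cases hij : j = i
      · subst hij; simp
      · simp [hij]
    · exact le_rfl
  · rw [key xbar, hxbar_feas.1, dotProduct_comm, left_eq_add]
    refine Finset.sum_eq_zero fun i _ => ?_
    split_ifs with hi <;> simp [hi]

/-- If the primal `min c·x s.t. Ax = b, x ≥ 0` has an optimal solution `x̄`,
then for every penalty vector `v ≥ x̄` the optimal value of the penalized dual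
`max b·π − v·ζ s.t. Aᵀπ ≤ c + ζ, ζ ≥ 0` equals the optimal value `c·x̄` of the
primal, and hence also the optimal value of the (unpenalized) dual
`max b·π s.t. Aᵀπ ≤ c` (optimal values taken in the extended reals). -/
theorem penalized_dual_value_eq {m n : ℕ}
    (A : Matrix (Fin m) (Fin n) ℝ) (b : Fin m → ℝ) (c : Fin n → ℝ)
    (xbar : Fin n → ℝ)
    (hxbar_feas : A.mulVec xbar = b ∧ 0 ≤ xbar)
    (hxbar_opt : ∀ x : Fin n → ℝ, A.mulVec x = b → 0 ≤ x → c ⬝ᵥ xbar ≤ c ⬝ᵥ x)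
    (v : Fin n → ℝ) (hv : xbar ≤ v) :
    sSup {w : EReal | ∃ π : Fin m → ℝ, ∃ ζ : Fin n → ℝ,
        Aᵀ.mulVec π ≤ c + ζ ∧ 0 ≤ ζ ∧ w = ((b ⬝ᵥ π - v ⬝ᵥ ζ : ℝ) : EReal)} =
      ((c ⬝ᵥ xbar : ℝ) : EReal) ∧
    sSup {w : EReal | ∃ π : Fin m → ℝ, ∃ ζ : Fin n → ℝ,
        Aᵀ.mulVec π ≤ c + ζ ∧ 0 ≤ ζ ∧ w = ((b ⬝ᵥ π - v ⬝ᵥ ζ : ℝ) : EReal)} =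
      sSup {w : EReal | ∃ π : Fin m → ℝ, Aᵀ.mulVec π ≤ c ∧ w = ((b ⬝ᵥ π : ℝ) : EReal)} := by
  obtain ⟨π0, h0, h0v⟩ := dual_attained A b c xbar hxbar_feas hxbar_opt
  have weak : ∀ (π : Fin m → ℝ) (ζ : Fin n → ℝ), Aᵀ.mulVec π ≤ c + ζ → 0 ≤ ζ →
      b ⬝ᵥ π - v ⬝ᵥ ζ ≤ c ⬝ᵥ xbar := by
    intro π ζ h hz
    have h1 : b ⬝ᵥ π = Aᵀ.mulVec π ⬝ᵥ xbar := by
      rw [← hxbar_feas.1, dotProduct_comm, dotProduct_mulVec, ← Matrix.mulVec_transpose]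
    have h2 := dotProduct_le_dotProduct_of_nonneg_right h hxbar_feas.2
    have h3 := dotProduct_le_dotProduct_of_nonneg_right hv hz
    rw [add_dotProduct, dotProduct_comm ζ] at h2
    linarith
  have e1 : sSup {w : EReal | ∃ π : Fin m → ℝ, ∃ ζ : Fin n → ℝ,
        Aᵀ.mulVec π ≤ c + ζ ∧ 0 ≤ ζ ∧ w = ((b ⬝ᵥ π - v ⬝ᵥ ζ : ℝ) : EReal)} =
      ((c ⬝ᵥ xbar : ℝ) : EReal) := by
    apply le_antisymm
    · apply sSup_le
      rintro w ⟨π, ζ, h, hz, rfl⟩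
      exact EReal.coe_le_coe_iff.mpr (weak π ζ h hz)
    · apply le_sSup
      exact ⟨π0, 0, by simpa using h0, le_rfl, by simp [h0v]⟩
  refine ⟨e1, e1.trans ?_⟩
  apply le_antisymm
  · apply le_sSup
    exact ⟨π0, h0, by rw [h0v]⟩
  · apply sSup_le
    rintro w ⟨π, h, rfl⟩
    have := weak π 0 (by simpa using h) le_rfl
    simp only [dotProduct_zero, sub_zero] at this
    exact EReal.coe_le_coe_iff.mpr this
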